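/- For every quaternion tensor with frontal slices T₁,…,T_m ∈ ℍ^{n₁×n₂}, there exist quaternion slices U₁,…,U_m ∈ ℍ^{n₁×n₁}, S₁,…,S_m ∈ ℍ^{n₁×n₂}, and V₁,…,V_m ∈ ℍ^{n₂×n₂} such that: (i) each S_t is diagonal, i.e. (S_t)_{ij} = 0 whenever i ≠ j; (ii) bcirc(U) is unitary, i.e. bcirc(U)ᴴ·bcirc(U) = bcirc(U)·bcirc(U)ᴴ = I, and likewise bcirc(V) is unitary; and (iii) bcirc(T) = bcirc(U)·bcirc(S)·bcirc(V)ᴴ. (This is the quaternion tensor singular value decomposition T = U ⋆ S ⋆ V*, expressed through block circulant matrices, using that the t-product satisfies bcirc(X ⋆ Y) = bcirc(X)·bcirc(Y) and bcirc(X*) = bcirc(X)ᴴ.) -/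

import Mathlib

open Quaternion Matrix

/-- The block circulant matrix of the frontal slices `X₁, …, X_m`: its `(s,t)` block
(0-indexed) is `X_{((s−t) mod m)+1}`. -/
noncomputable def bcirc {m n₁ n₂ : ℕ} (X : Fin m → Matrix (Fin n₁) (Fin n₂) ℍ[ℝ]) :
    Matrix (Fin m × Fin n₁) (Fin m × Fin n₂) ℍ[ℝ] :=
  Matrix.of fun p q => X (p.1 - q.1) p.2 q.2

theorem exists_unitary_curve {A : Type*} [NormedRing A] [NormedAlgebra ℝ A] [CompleteSpace A]
    [StarRing A] (hcs : Continuous (star : A → A)) (X : A) (hX : star X = -X)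
    (hX' : ∀ t : ℝ, star (t • X) = t • star X) :
    ∃ W : ℝ → A, HasDerivAt W X 0 ∧ W 0 = 1 ∧
      (∀ t, star (W t) * W t = 1 ∧ W t * star (W t) = 1) ∧
      ∀ t, ∀ f : A →+* A, Continuous f → f (t • X) = t • X → f (W t) = W t := by
  have : ContinuousStar A := ⟨hcs⟩
  let _ : NormedAlgebra ℚ A := NormedAlgebra.restrictScalars ℚ ℝ A
  have hneg : ∀ t : ℝ, star (NormedSpace.exp (t • X)) = NormedSpace.exp (-(t • X)) := by
    intro t
    rw [NormedSpace.star_exp, hX', hX, smul_neg]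
  refine ⟨fun t => NormedSpace.exp (t • X), ?_, by simp, ?_, ?_⟩
  · simpa using hasDerivAt_exp_smul_const (𝕂 := ℝ) X (0 : ℝ)
  · intro t
    simp only [hneg]
    constructor
    · rw [← NormedSpace.exp_add_of_commute (Commute.refl (t • X)).neg_left]; simp
    · rw [← NormedSpace.exp_add_of_commute (Commute.refl (t • X)).neg_right]; simp
  · intro t f hf h
    simp only
    rw [NormedSpace.map_exp f hf, h]

/-- real part of the trace -/
noncomputable def rtr {n : Type*} [Fintype n] (A : Matrix n n ℍ[ℝ]) : ℝ := ∑ i, (A i i).re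

theorem rtr_add {n : Type*} [Fintype n] (A B : Matrix n n ℍ[ℝ]) : rtr (A + B) = rtr A + rtr B := by
  simp [rtr, Finset.sum_add_distrib]

theorem rtr_neg {n : Type*} [Fintype n] (A : Matrix n n ℍ[ℝ]) : rtr (-A) = - rtr A := by
  simp [rtr]

theorem rtr_sub {n : Type*} [Fintype n] (A B : Matrix n n ℍ[ℝ]) : rtr (A - B) = rtr A - rtr B := by
  rw [sub_eq_add_neg, rtr_add, rtr_neg, sub_eq_add_neg]

theorem rtr_smul {n : Type*} [Fintype n] (c : ℝ) (A : Matrix n n ℍ[ℝ]) :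
    rtr (c • A) = c * rtr A := by
  simp [rtr, Finset.mul_sum]

theorem rtr_conjTranspose {n : Type*} [Fintype n] (A : Matrix n n ℍ[ℝ]) : rtr Aᴴ = rtr A := by
  simp [rtr]

/-- the real part as an additive hom -/
noncomputable def reHom : ℍ[ℝ] →+ ℝ where
  toFun := fun q => q.re
  map_zero' := rfl
  map_add' := fun _ _ => rfl

theorem re_sum {ι : Type*} (s : Finset ι) (f : ι → ℍ[ℝ]) : (∑ i ∈ s, f i).re = ∑ i ∈ s, (f i).re :=
  map_sum reHom f s

theorem rtr_mul_comm {n k : Type*} [Fintype n] [Fintype k] (A : Matrix n k ℍ[ℝ])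
    (B : Matrix k n ℍ[ℝ]) : rtr (A * B) = rtr (B * A) := by
  simp only [rtr, Matrix.mul_apply, re_sum]
  rw [Finset.sum_comm]
  refine Finset.sum_congr rfl fun i _ => Finset.sum_congr rfl fun j _ => ?_
  simp only [Quaternion.re_mul]
  ring

theorem rtr_mul_self {n k : Type*} [Fintype n] [Fintype k] (A : Matrix n k ℍ[ℝ])
    (h : rtr (A * Aᴴ) = 0) : A = 0 := by
  simp only [rtr, Matrix.mul_apply, re_sum, Matrix.conjTranspose_apply] at h
  have hn : ∀ q : ℍ[ℝ], (q * star q).re = ‖q‖ ^ 2 := by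
    intro q
    rw [Quaternion.self_mul_star, Quaternion.re_coe, Quaternion.normSq_eq_norm_mul_self, sq]
  simp only [hn] at h
  ext1 i j
  have h1 := (Finset.sum_eq_zero_iff_of_nonneg
    (fun i _ => Finset.sum_nonneg fun j _ => sq_nonneg _)).1 h i (Finset.mem_univ _)
  have h2 := (Finset.sum_eq_zero_iff_of_nonneg (fun j _ => sq_nonneg _)).1 h1 j (Finset.mem_univ _)
  simpa using h2

theorem rtr_continuous {n : Type*} [Fintype n] :
    Continuous (rtr : Matrix n n ℍ[ℝ] → ℝ) := by
  unfold rtr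
  refine continuous_finsetSum _ fun i _ => ?_
  exact Quaternion.continuous_re.comp (continuous_id.matrix_elem i i)

/-- shift -/
def shiftE {m : ℕ} [NeZero m] (n : ℕ) (a : Fin m) : Fin m × Fin n ≃ Fin m × Fin n :=
  (Equiv.addRight a).prodCongr (Equiv.refl _)

/-- block circulant -/
def IsCirc {m n k : ℕ} [NeZero m] (A : Matrix (Fin m × Fin n) (Fin m × Fin k) ℍ[ℝ]) : Prop :=
  ∀ a : Fin m, A.submatrix (shiftE n a) (shiftE k a) = A

section
variable {m n k l : ℕ} [NeZero m]

theorem IsCirc.mul {A : Matrix (Fin m × Fin n) (Fin m × Fin k) ℍ[ℝ]}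
    {B : Matrix (Fin m × Fin k) (Fin m × Fin l) ℍ[ℝ]} (hA : IsCirc A) (hB : IsCirc B) :
    IsCirc (A * B) := by
  intro a
  rw [← Matrix.submatrix_mul_equiv A B _ (shiftE k a) _, hA, hB]

theorem IsCirc.conjTranspose {A : Matrix (Fin m × Fin n) (Fin m × Fin k) ℍ[ℝ]}
    (hA : IsCirc A) : IsCirc Aᴴ := by
  intro a
  rw [← Matrix.conjTranspose_submatrix, hA]

theorem IsCirc.sub {A B : Matrix (Fin m × Fin n) (Fin m × Fin k) ℍ[ℝ]}
    (hA : IsCirc A) (hB : IsCirc B) : IsCirc (A - B) := by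
  intro a
  rw [Matrix.submatrix_sub, Pi.sub_apply, Pi.sub_apply, hA, hB]

theorem IsCirc.one : IsCirc (1 : Matrix (Fin m × Fin n) (Fin m × Fin n) ℍ[ℝ]) := by
  intro a
  simp

theorem isCirc_bcirc (X : Fin m → Matrix (Fin n) (Fin k) ℍ[ℝ]) : IsCirc (bcirc X) := by
  intro a
  ext1 p q
  simp [bcirc, shiftE]

theorem IsCirc.exists_bcirc {A : Matrix (Fin m × Fin n) (Fin m × Fin k) ℍ[ℝ]}
    (hA : IsCirc A) : bcirc (fun t => Matrix.of fun i j => A (t, i) (0, j)) = A := by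
  ext1 p q
  have := congrFun (congrFun (hA q.1) (p.1 - q.1, p.2)) (0, q.2)
  simp only [shiftE, Matrix.submatrix_apply, Equiv.prodCongr_apply, Prod.map, Equiv.coe_addRight,
    sub_add_cancel, zero_add, Equiv.refl_apply, Prod.mk.eta] at this
  simp [bcirc, this]

/-- unitary circulants -/
def UC (m n : ℕ) [NeZero m] : Set (Matrix (Fin m × Fin n) (Fin m × Fin n) ℍ[ℝ]) :=
  {W | IsCirc W ∧ Wᴴ * W = 1 ∧ W * Wᴴ = 1}

attribute [local instance] Matrix.linftyOpNormedRing Matrix.linftyOpNormedAlgebra in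
theorem exists_curve (X : Matrix (Fin m × Fin n) (Fin m × Fin n) ℍ[ℝ]) (hX : Xᴴ = -X)
    (hc : IsCirc X) (A : Matrix (Fin m × Fin n) (Fin m × Fin n) ℍ[ℝ])
    (hmax : ∀ W ∈ UC m n, rtr (W * A) ≤ rtr A) : rtr (X * A) = 0 := by
  obtain ⟨W, hd, h0, hu, hf⟩ := exists_unitary_curve
    (continuous_id.matrix_conjTranspose) X hX
    (fun t => by rw [Matrix.star_eq_conjTranspose, Matrix.star_eq_conjTranspose]; ext1; simp)
  let L : Matrix (Fin m × Fin n) (Fin m × Fin n) ℍ[ℝ] →L[ℝ] ℝ :=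
    ⟨{ toFun := fun Y => rtr (Y * A)
       map_add' := fun Y Z => by rw [add_mul, rtr_add]
       map_smul' := fun c Y => by rw [smul_mul_assoc, rtr_smul]; rfl },
      rtr_continuous.comp (continuous_id.matrix_mul continuous_const)⟩
  have hL : HasDerivAt (fun t => L (W t)) (L X) 0 := L.hasFDerivAt.comp_hasDerivAt 0 hd
  have hm : IsLocalMax (fun t => L (W t)) 0 := by
    refine Filter.Eventually.of_forall fun t => ?_
    have := hmax (W t) ⟨fun a => ?_, hu t⟩
    · show rtr (W t * A) ≤ rtr (W 0 * A)
      rwa [h0, one_mul]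
    · let f : Matrix (Fin m × Fin n) (Fin m × Fin n) ℍ[ℝ] →+*
          Matrix (Fin m × Fin n) (Fin m × Fin n) ℍ[ℝ] :=
        (Matrix.reindexRingEquiv ℍ[ℝ] (shiftE n a).symm).toRingHom
      refine hf t f ?_ ?_
      · exact continuous_id.matrix_submatrix _ _
      · show (t • X).submatrix (shiftE n a) (shiftE n a) = t • X
        rw [Matrix.submatrix_smul, Pi.smul_apply, Pi.smul_apply, hc a]
  exact hm.hasDerivAt_eq_zero hL

theorem herm_of_max (A : Matrix (Fin m × Fin n) (Fin m × Fin n) ℍ[ℝ]) (hA : IsCirc A)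
    (hmax : ∀ W ∈ UC m n, rtr (W * A) ≤ rtr A) : Aᴴ = A := by
  have h1 : rtr ((A - Aᴴ) * A) = 0 :=
    exists_curve (A - Aᴴ) (by simp) (hA.sub hA.conjTranspose) A hmax
  have h2 : rtr ((A - Aᴴ) * Aᴴ) = 0 := by
    rw [← rtr_conjTranspose, Matrix.conjTranspose_mul, Matrix.conjTranspose_conjTranspose,
      rtr_mul_comm, Matrix.conjTranspose_sub, Matrix.conjTranspose_conjTranspose,
      ← neg_sub, neg_mul, rtr_neg, h1, neg_zero]
  have h3 := rtr_mul_self (A - Aᴴ) (by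
    rw [Matrix.conjTranspose_sub, Matrix.conjTranspose_conjTranspose, mul_sub, rtr_sub, h1, h2,
      sub_zero])
  exact (sub_eq_zero.1 h3).symm

theorem isCompact_UC : IsCompact (UC m n) := by
  have : ProperSpace ℍ[ℝ] := FiniteDimensional.proper_real _
  have hK : IsCompact (Set.pi Set.univ fun _ : Fin m × Fin n => Set.pi Set.univ
      fun _ : Fin m × Fin n => Metric.closedBall (0 : ℍ[ℝ]) 1) :=
    isCompact_univ_pi fun _ => isCompact_univ_pi fun _ => isCompact_closedBall _ _
  refine hK.of_isClosed_subset ?_ ?_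
  · have e : UC m n = (⋂ a : Fin m, {W | W.submatrix (shiftE n a) (shiftE n a) = W}) ∩
        ({W | Wᴴ * W = 1} ∩ {W | W * Wᴴ = 1}) := by
      ext W; simp [UC, IsCirc]
    rw [e]
    refine (isClosed_iInter fun a => ?_).inter (IsClosed.inter ?_ ?_)
    · exact isClosed_eq (continuous_id.matrix_submatrix _ _) continuous_id
    · exact isClosed_eq (continuous_id.matrix_conjTranspose.matrix_mul continuous_id)
        continuous_const
    · exact isClosed_eq (continuous_id.matrix_mul continuous_id.matrix_conjTranspose)
        continuous_const
  · intro (W : Matrix (Fin m × Fin n) (Fin m × Fin n) ℍ[ℝ]) hW i _ j _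
    have h := hW.2.2
    have h1 := congrArg (fun q : ℍ[ℝ] => q.re) (show (W * Wᴴ) i i = (1 : Matrix _ _ ℍ[ℝ]) i i by rw [h])
    have hn : ∀ q : ℍ[ℝ], (q * star q).re = ‖q‖ ^ 2 := by
      intro q
      rw [Quaternion.self_mul_star, Quaternion.re_coe, Quaternion.normSq_eq_norm_mul_self, sq]
    simp only [Matrix.mul_apply, re_sum, Matrix.conjTranspose_apply, hn, Matrix.one_apply_eq,
      Quaternion.re_one] at h1
    have h2 : ‖W i j‖ ^ 2 ≤ 1 := by
      rw [← h1]
      exact Finset.single_le_sum (f := fun x => ‖W i x‖ ^ 2) (fun x _ => sq_nonneg _)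
        (Finset.mem_univ j)
    rw [mem_closedBall_zero_iff]
    nlinarith [norm_nonneg (W i j)]

theorem UC.mul {U W : Matrix (Fin m × Fin n) (Fin m × Fin n) ℍ[ℝ]} (hU : U ∈ UC m n)
    (hW : W ∈ UC m n) : U * W ∈ UC m n := by
  obtain ⟨h1, h2, h3⟩ := hU
  obtain ⟨g1, g2, g3⟩ := hW
  refine ⟨h1.mul g1, ?_, ?_⟩
  · rw [Matrix.conjTranspose_mul, mul_assoc, ← mul_assoc Uᴴ, h2, one_mul, g2]
  · rw [Matrix.conjTranspose_mul, mul_assoc, ← mul_assoc W, g3, one_mul, h3]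

theorem UC.star {U : Matrix (Fin m × Fin n) (Fin m × Fin n) ℍ[ℝ]} (hU : U ∈ UC m n) :
    Uᴴ ∈ UC m n := by
  obtain ⟨h1, h2, h3⟩ := hU
  exact ⟨h1.conjTranspose, by simpa using h3, by simpa using h2⟩

/-- weight matrix -/
noncomputable def wD (m n k : ℕ) : Matrix (Fin m × Fin n) (Fin m × Fin k) ℍ[ℝ] :=
  Matrix.of fun p q => if p.1 = q.1 ∧ (p.2 : ℕ) = q.2 then (((p.2 : ℕ) + 1 : ℝ) : ℍ[ℝ]) else 0

theorem wD_star : (wD m n k)ᴴ = wD m k n := by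
  ext1 p q
  simp only [wD, Matrix.conjTranspose_apply, Matrix.of_apply]
  by_cases h : p.1 = q.1 ∧ (p.2 : ℕ) = q.2
  · rw [if_pos h, if_pos ⟨h.1.symm, h.2.symm⟩, Quaternion.star_coe, h.2]
  · rw [if_neg h, if_neg (fun g => h ⟨g.1.symm, g.2.symm⟩), star_zero]

theorem wD_circ : IsCirc (wD m n k) := by
  intro a
  ext1 p q
  simp [wD, shiftE]

/-- the eigenvalue -/
noncomputable def ev (k i : ℕ) : ℝ := if i < k then ((i : ℝ) + 1) ^ 2 else 0

theorem wD_mul : wD m n k * wD m k n = Matrix.diagonal fun p => ((ev k p.2 : ℝ) : ℍ[ℝ]) := by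
  ext1 p q
  rw [Matrix.mul_apply, Matrix.diagonal_apply]
  by_cases hk : (p.2 : ℕ) < k
  · rw [Finset.sum_eq_single (p.1, ⟨p.2, hk⟩)]
    · by_cases hpq : p = q
      · subst hpq
        simp [wD, ev, hk, sq]
      · have : ¬ (p.1 = q.1 ∧ (p.2 : ℕ) = q.2) := fun h => hpq (Prod.ext h.1 (Fin.ext h.2))
        simp [wD, hpq, this]
    · intro r _ hr
      have : ¬ (p.1 = r.1 ∧ (p.2 : ℕ) = r.2) := fun h =>
        hr (Prod.ext h.1.symm (Fin.ext h.2.symm))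
      simp [wD, this]
    · simp
  · rw [Finset.sum_eq_zero]
    · simp [ev, hk]
    · intro r _
      have : ¬ (p.1 = r.1 ∧ (p.2 : ℕ) = r.2) := fun h => hk (h.2 ▸ r.2.2)
      simp [wD, this]

theorem ev_ne {i j : ℕ} (hi : i < n) (hj : j < k) (h : i ≠ j) : ev k i ≠ ev n j := by
  unfold ev
  split_ifs with h1 h2 h2
  · intro e
    have := (sq_eq_sq₀ (by positivity) (by positivity)).1 e
    exact h (by exact_mod_cast add_right_cancel this)
  · positivity
  · exact (by positivity : (0:ℝ) < ((j:ℝ)+1)^2).ne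
  · omega

theorem diag_of_herm (M : Matrix (Fin m × Fin n) (Fin m × Fin k) ℍ[ℝ])
    (h1 : (M * wD m k n)ᴴ = M * wD m k n) (h2 : (wD m k n * M)ᴴ = wD m k n * M)
    (p : Fin m × Fin n) (q : Fin m × Fin k) (h : (p.2 : ℕ) ≠ q.2) : M p q = 0 := by
  rw [Matrix.conjTranspose_mul, wD_star] at h1 h2
  have key : M * (wD m k n * wD m n k) = (wD m n k * wD m k n) * M := by
    rw [← Matrix.mul_assoc, ← h1, Matrix.mul_assoc, h2, Matrix.mul_assoc]
  rw [wD_mul, wD_mul] at key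
  have e := congrFun (congrFun key p) q
  rw [Matrix.mul_diagonal, Matrix.diagonal_mul, ← Quaternion.coe_commutes, ← sub_eq_zero,
    ← sub_mul, ← Quaternion.coe_sub, mul_eq_zero] at e
  rcases e with e | e
  · exfalso
    have e' : ev n q.2 - ev k p.2 = 0 := Quaternion.coe_injective (by simpa using e)
    exact ev_ne p.2.2 q.2.2 h (sub_eq_zero.1 e').symm
  · exact e

theorem circ_svd (T : Matrix (Fin m × Fin n) (Fin m × Fin k) ℍ[ℝ]) (hT : IsCirc T) :
    ∃ U ∈ UC m n, ∃ V ∈ UC m k, ∀ (p : Fin m × Fin n) (q : Fin m × Fin k), (p.2 : ℕ) ≠ q.2 →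
      (Uᴴ * T * V) p q = 0 := by
  have hc : Continuous fun x : Matrix (Fin m × Fin n) (Fin m × Fin n) ℍ[ℝ] ×
      Matrix (Fin m × Fin k) (Fin m × Fin k) ℍ[ℝ] => rtr (wD m k n * (x.1ᴴ * T * x.2)) :=
    rtr_continuous.comp (continuous_const.matrix_mul
      ((continuous_fst.matrix_conjTranspose.matrix_mul continuous_const).matrix_mul
        continuous_snd))
  have one_mem : ∀ n', (1 : Matrix (Fin m × Fin n') (Fin m × Fin n') ℍ[ℝ]) ∈ UC m n' :=
    fun n' => ⟨IsCirc.one, by simp, by simp⟩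
  obtain ⟨⟨U, V⟩, ⟨hU, hV⟩, hmax⟩ := (isCompact_UC (m := m) (n := n)).prod
    (isCompact_UC (m := m) (n := k)) |>.exists_isMaxOn ⟨(1, 1), one_mem n, one_mem k⟩
      hc.continuousOn
  have hM : IsCirc (Uᴴ * T * V) := (hU.1.conjTranspose.mul hT).mul hV.1
  refine ⟨U, hU, V, hV, diag_of_herm _ ?_ ?_⟩
  · refine herm_of_max _ (hM.mul wD_circ) fun W hW => ?_
    have := hmax (show (U * Wᴴ, V) ∈ UC m n ×ˢ UC m k from ⟨UC.mul hU (UC.star hW), hV⟩)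
    simp only [Set.mem_ofPred_eq, Matrix.conjTranspose_mul, Matrix.conjTranspose_conjTranspose]
      at this
    rw [rtr_mul_comm, rtr_mul_comm (wD m k n)] at this
    simpa only [Matrix.mul_assoc] using this
  · refine herm_of_max _ (wD_circ.mul hM) fun W hW => ?_
    have := hmax (show (U, V * W) ∈ UC m n ×ˢ UC m k from ⟨hU, UC.mul hV hW⟩)
    simp only [Set.mem_ofPred_eq] at this
    rw [rtr_mul_comm W]
    simpa only [Matrix.mul_assoc] using this

end

/-- quaternion tensor SVD, via block circulant matrices: for every quaternion
tensor with frontal slices `T₁,…,T_m ∈ ℍ^{n₁×n₂}` there exist slices `U`, `S`, `V` such that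
each `S_t` is diagonal, `bcirc(U)` and `bcirc(V)` are unitary, and
`bcirc(T) = bcirc(U)·bcirc(S)·bcirc(V)ᴴ`. -/
theorem quaternion_tensor_svd (m n₁ n₂ : ℕ) (T : Fin m → Matrix (Fin n₁) (Fin n₂) ℍ[ℝ]) :
    ∃ (U : Fin m → Matrix (Fin n₁) (Fin n₁) ℍ[ℝ])
      (S : Fin m → Matrix (Fin n₁) (Fin n₂) ℍ[ℝ])
      (V : Fin m → Matrix (Fin n₂) (Fin n₂) ℍ[ℝ]),
      (∀ (t : Fin m) (i : Fin n₁) (j : Fin n₂), (i : ℕ) ≠ (j : ℕ) → S t i j = 0) ∧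
      (bcirc U)ᴴ * bcirc U = 1 ∧ bcirc U * (bcirc U)ᴴ = 1 ∧
      (bcirc V)ᴴ * bcirc V = 1 ∧ bcirc V * (bcirc V)ᴴ = 1 ∧
      bcirc T = bcirc U * bcirc S * (bcirc V)ᴴ := by
  rcases Nat.eq_zero_or_pos m with rfl | hm
  · refine ⟨fun _ => 0, fun _ => 0, fun _ => 0, fun t => t.elim0, ?_, ?_, ?_, ?_, ?_⟩ <;>
      exact Matrix.ext fun p => p.1.elim0
  have : NeZero m := ⟨hm.ne'⟩
  obtain ⟨U, hU, V, hV, hd⟩ := circ_svd (bcirc T) (isCirc_bcirc T)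
  have hM : IsCirc (Uᴴ * bcirc T * V) := (hU.1.conjTranspose.mul (isCirc_bcirc T)).mul hV.1
  refine ⟨fun t => Matrix.of fun i j => U (t, i) (0, j),
    fun t => Matrix.of fun i j => (Uᴴ * bcirc T * V) (t, i) (0, j),
    fun t => Matrix.of fun i j => V (t, i) (0, j), ?_, ?_⟩
  rotate_left
  · rw [hU.1.exists_bcirc, hV.1.exists_bcirc, hM.exists_bcirc]
    refine ⟨hU.2.1, hU.2.2, hV.2.1, hV.2.2, ?_⟩
    rw [Matrix.mul_assoc, Matrix.mul_assoc, hV.2.2, Matrix.mul_one, ← Matrix.mul_assoc, hU.2.2,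
      Matrix.one_mul]
  · intro t i j hij
    exact hd (t, i) (0, j) hij
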